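/- arXiv:1108.6309 — 2 statements merged into one kernel-verified Lean document; each statement's English description precedes it below -/
import Mathlib

section
/- Let T be a triangulated category with arbitrary small coproducts, P a compact generator of T, and suppose Λ is N-sparse and gl dim Λ < N. Fix i ∈ ℤ/N and let X, Y be objects of T with π_*X ∈ B[i] and π_*Y ∈ B[i]. Then there is a natural isomorphism of abelian groups Hom_T(ΣX, Y) ≅ Ext^{N−1}_Λ((π_*X)[N], π_*Y). -/
/-!
Shared setup: a triangulated category `C` with (co)products, a compact generator `P`,
the graded endomorphism ring `Λ = End_T(P)_* = Hom_T(Σ^* P, P)` and its category of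
graded right modules, realized concretely.
-/

set_option linter.unusedSectionVars false

open CategoryTheory CategoryTheory.Limits CategoryTheory.Pretriangulated DirectSum

universe v u

namespace Franke

variable {C : Type u} [Category.{v} C] [Preadditive C] [HasZeroObject C]
  [HasShift C ℤ] [∀ n : ℤ, (shiftFunctor C n).Additive] [Pretriangulated C]

/-- The degree `k` component of the graded endomorphism ring
`Λ = End_T(P)_* = Hom_T(Σ^* P, P)`: its degree `k` part is `Hom(P⟦k⟧, P)`. -/
abbrev lam (P : C) (k : ℤ) : Type v := (P⟦k⟧ ⟶ P)

/-- The right action of a degree `k` element `a : Σᵏ P ⟶ P` of `Λ` on a degree `n`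
element `m : Σⁿ P ⟶ X` of the graded hom `π_* X = Hom_T(Σ^* P, X)`; the result is the
degree `n + k` element `Σ^{n+k} P ≅ (Σᵏ P)⟦n⟧ → Σⁿ P → X`. -/
def gsmulHom (P : C) {X : C} {n k l : ℤ} (h : n + k = l)
    (m : P⟦n⟧ ⟶ X) (a : lam P k) : P⟦l⟧ ⟶ X :=
  (shiftFunctorAdd' C k n l (by omega)).hom.app P ≫ a⟦n⟧' ≫ m

/-- The multiplication of the graded endomorphism ring `Λ = End_T(P)_*`. -/
def gmul (P : C) {j k l : ℤ} (h : j + k = l) (a : lam P j) (b : lam P k) : lam P l :=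
  gsmulHom P h a b

/-- The unit `1 ∈ Λ₀ = Hom(Σ⁰P, P)` of the graded endomorphism ring. -/
def gone (P : C) : lam P 0 := (shiftFunctorZero C ℤ).hom.app P

/-- A ℤ-graded right module over the graded endomorphism ring `Λ = End_T(P)_*`.
The action is indexed by proofs `n + k = l` in order to avoid transport along
equalities of degrees. -/
structure GradedModule (P : C) where
  M : ℤ → Type v
  [acg : ∀ n, AddCommGroup (M n)]
  smul : ∀ {n k l : ℤ}, n + k = l → M n → lam P k → M l
  smul_addₓ : ∀ {n k l : ℤ} (h : n + k = l) (m : M n) (a b : lam P k),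
    smul h m (a + b) = smul h m a + smul h m b
  add_smulₓ : ∀ {n k l : ℤ} (h : n + k = l) (m m' : M n) (a : lam P k),
    smul h (m + m') a = smul h m a + smul h m' a
  smul_oneₓ : ∀ {n : ℤ} (m : M n), smul (add_zero n) m (gone P) = m
  smul_mulₓ : ∀ {n j k nj jk njk : ℤ} (h₁ : n + j = nj) (h₂ : j + k = jk)
    (h₃ : nj + k = njk) (h₄ : n + jk = njk) (m : M n) (a : lam P j) (b : lam P k),
    smul h₃ (smul h₁ m a) b = smul h₄ m (gmul P h₂ a b)

attribute [instance] GradedModule.acg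

/-- The action of a fixed `a : Λₖ` as an additive map `Mₙ →+ M_{n+k}`. -/
def GradedModule.smulAddHom {P : C} (M : GradedModule P) {n k l : ℤ} (h : n + k = l)
    (a : lam P k) : M.M n →+ M.M l :=
  AddMonoidHom.mk' (fun m => M.smul h m a) (fun m m' => M.add_smulₓ h m m' a)

theorem GradedModule.zero_smulₓ {P : C} (M : GradedModule P) {n k l : ℤ} (h : n + k = l)
    (a : lam P k) : M.smul h (0 : M.M n) a = 0 :=
  map_zero (M.smulAddHom h a)

/-- `π_* X = Hom_T(Σ^* P, X)` as a graded right `Λ`-module. -/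
@[reducible] def piMod (P X : C) : GradedModule P where
  M n := P⟦n⟧ ⟶ X
  smul h m a := gsmulHom P h m a
  smul_addₓ h m a b := by
    simp [gsmulHom, Functor.map_add, Preadditive.comp_add, Preadditive.add_comp]
  add_smulₓ h m m' a := by
    simp [gsmulHom, Preadditive.comp_add]
  smul_oneₓ m := by
    simp only [gsmulHom, gone]
    rw [shiftFunctorAdd'_zero_add_hom_app, ← Functor.map_comp_assoc, Iso.inv_hom_id_app]
    simp
  smul_mulₓ {n j k nj jk njk} h₁ h₂ h₃ h₄ m a b := by
    simp only [gsmulHom, gmul, Functor.map_comp, Category.assoc]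
    have nat := ((shiftFunctorAdd' C j n nj (by omega)).hom).naturality b
    dsimp at nat
    rw [reassoc_of% nat]
    rw [← shiftFunctorAdd'_assoc_hom_app_assoc k j n jk nj njk (by omega) (by omega)
      (by omega) P]


/-- A morphism of graded right `Λ`-modules: a degree-preserving `Λ`-linear additive map. -/
structure GHom {P : C} (M N : GradedModule P) where
  app : ∀ n : ℤ, M.M n →+ N.M n
  app_smul : ∀ {n k l : ℤ} (h : n + k = l) (m : M.M n) (a : lam P k),
    app l (M.smul h m a) = N.smul h (app n m) a

@[ext] theorem GHom.ext {P : C} {M N : GradedModule P} {f g : GHom M N}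
    (h : ∀ (n : ℤ) (x : M.M n), f.app n x = g.app n x) : f = g := by
  obtain ⟨fa, _⟩ := f; obtain ⟨ga, _⟩ := g
  congr 1
  funext n
  exact AddMonoidHom.ext (h n)

/-- The identity morphism of graded modules. -/
def GHom.id {P : C} (M : GradedModule P) : GHom M M :=
  ⟨fun _ => AddMonoidHom.id _, fun _ _ _ => rfl⟩

/-- Composition of morphisms of graded modules. -/
def GHom.comp {P : C} {M N K : GradedModule P} (g : GHom N K) (f : GHom M N) : GHom M K :=
  ⟨fun n => (g.app n).comp (f.app n), fun h m a => by
    simp only [AddMonoidHom.comp_apply, f.app_smul, g.app_smul]⟩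

instance {P : C} {M N : GradedModule P} : Zero (GHom M N) :=
  ⟨{ app := fun _ => 0
     app_smul := fun h m a => by
       show (0 : N.M _) = N.smul h (0 : N.M _) a
       exact (N.zero_smulₓ h a).symm }⟩

@[simp] theorem GHom.zero_app {P : C} {M N : GradedModule P} (n : ℤ) (x : M.M n) :
    (0 : GHom M N).app n x = 0 := rfl

/-- An isomorphism of graded right `Λ`-modules. -/
structure GIso {P : C} (M N : GradedModule P) where
  hom : GHom M N
  inv : GHom N M
  hom_inv_id : inv.comp hom = GHom.id M
  inv_hom_id : hom.comp inv = GHom.id N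

/-- The shift `M[k]` of a graded module, with `M[k]ₙ = M_{n-k}`. -/
@[reducible] def gshift {P : C} (k : ℤ) (M : GradedModule P) : GradedModule P where
  M n := M.M (n - k)
  smul h m a := M.smul (by omega) m a
  smul_addₓ h m a b := M.smul_addₓ _ m a b
  add_smulₓ h m m' a := M.add_smulₓ _ m m' a
  smul_oneₓ m := M.smul_oneₓ m
  smul_mulₓ h₁ h₂ h₃ h₄ m a b := M.smul_mulₓ _ h₂ _ _ m a b

/-- Surjectivity (in each degree) of a morphism of graded modules. -/
def GHom.Surj {P : C} {M N : GradedModule P} (f : GHom M N) : Prop :=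
  ∀ n : ℤ, Function.Surjective (f.app n)

/-- A pair of composable morphisms of graded modules `0 → Z → E → B → 0`
forming a short exact sequence. -/
structure IsShortExact {P : C} {Z E B : GradedModule P} (ι : GHom Z E) (ρ : GHom E B) : Prop where
  mono : ∀ n : ℤ, Function.Injective (ι.app n)
  epi : ∀ n : ℤ, Function.Surjective (ρ.app n)
  exact : ∀ (n : ℤ) (x : E.M n), ρ.app n x = 0 ↔ x ∈ Set.range (ι.app n)

/-- Exactness of `M → N → K` at `N` (including that the composite vanishes). -/
def ExactPair {P : C} {M N K : GradedModule P} (f : GHom M N) (g : GHom N K) : Prop :=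
  ∀ (n : ℤ) (x : N.M n), g.app n x = 0 ↔ x ∈ Set.range (f.app n)

/-- A graded module is projective if every degreewise surjection onto it splits against
any map from it: the usual lifting property. -/
def IsProjective {P : C} (Q : GradedModule P) : Prop :=
  ∀ (A B : GradedModule P) (e : GHom A B), e.Surj →
    ∀ f : GHom Q B, ∃ g : GHom Q A, e.comp g = f

/-- `projDimLE d M` says that the graded module `M` admits a projective resolution of
length at most `d`, i.e. has projective dimension `≤ d`. -/
def projDimLE {P : C} : ℕ → GradedModule P → Prop
  | 0, M => IsProjective M
  | d + 1, M => ∃ (F K : GradedModule P) (ε : GHom F M) (ι : GHom K F),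
      IsProjective F ∧ IsShortExact ι ε ∧ projDimLE d K

/-- `Λ = End_T(P)_*` is `N`-sparse: concentrated in degrees divisible by `N`. -/
def Sparse (P : C) (N : ℕ) : Prop :=
  ∀ k : ℤ, ¬ ((N : ℤ) ∣ k) → ∀ a : lam P k, a = 0

/-- A graded module belongs to `B[i]`: it is concentrated in degrees congruent
to `i` modulo `N`. -/
def InDegrees {P : C} (N : ℕ) (i : ZMod N) (M : GradedModule P) : Prop :=
  ∀ n : ℤ, (n : ZMod N) ≠ i → ∀ x : M.M n, x = 0

/-- The canonical comparison map `⊕ᵢ Hom(P, Xᵢ) → Hom(P, ∐ᵢ Xᵢ)`. -/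
noncomputable def compactComparison [HasCoproducts.{v} C] (P : C) {ι : Type v} (X : ι → C) :
    (⨁ i, (P ⟶ X i)) →+ (P ⟶ ∐ X) := by
  classical
  exact DirectSum.toAddMonoid fun i =>
    AddMonoidHom.mk' (fun f => f ≫ Sigma.ι X i) (fun f g => Preadditive.add_comp _ _ _ _ _ _)

/-- `P` is a compact object: `Hom(P, −)` commutes with small coproducts. -/
def IsCompactObj [HasCoproducts.{v} C] (P : C) : Prop :=
  ∀ (ι : Type v) (X : ι → C), Function.Bijective (compactComparison P X)

/-- `P` is a generator: an object all of whose graded homs from `P` vanish is zero. -/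
def IsGenerator (P : C) : Prop :=
  ∀ X : C, (∀ (n : ℤ) (f : P⟦n⟧ ⟶ X), f = 0) → IsZero X

/-- The morphism of graded modules `π_* f : π_* X → π_* Y` induced by `f : X ⟶ Y`. -/
def piGHom (P : C) {X Y : C} (f : X ⟶ Y) : GHom (piMod P X) (piMod P Y) where
  app n := AddMonoidHom.mk' (fun u => u ≫ f) fun u v => Preadditive.add_comp _ _ _ _ _ _
  app_smul h m a := by
    show (gsmulHom P h m a) ≫ f = gsmulHom P h (m ≫ f) a
    simp [gsmulHom]

/-- An extension of `B` by `Z` in the category of graded right `Λ`-modules: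
  a short exact sequence `0 → Z → E → B → 0`. -/
structure GExtension {P : C} (B Z : GradedModule P) where
  E : GradedModule P
  ι : GHom Z E
  ρ : GHom E B
  shortExact : IsShortExact ι ρ

/-- Two extensions are identified if there is a morphism of extensions between them
(such a morphism is automatically an isomorphism). -/
def GExtension.Rel {P : C} {B Z : GradedModule P} (e e' : GExtension B Z) : Prop :=
  ∃ φ : GHom e.E e'.E, φ.comp e.ι = e'.ι ∧ e'.ρ.comp φ = e.ρ

/-- `Ext¹_Λ(B, Z)`, realized as the set of equivalence classes of extensions
`0 → Z → E → B → 0` of graded right `Λ`-modules. -/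
def Ext1 {P : C} (B Z : GradedModule P) : Type _ :=
  Quot (GExtension.Rel (B := B) (Z := Z))

/-- Given `δ : Cc ⟶ ΣX`, the induced morphism of graded modules
`π_* Cc → (π_* X)[1]`, using the canonical identification `π_*(ΣX) ≅ (π_*X)[1]`. -/
noncomputable def triangleConnect (P : C) {X Cc : C} (δ : Cc ⟶ X⟦(1:ℤ)⟧) :
    GHom (piMod P Cc) (gshift 1 (piMod P X)) where
  app n := AddMonoidHom.mk' (fun u =>
    (shiftFunctorAdd' C n (-1) (n-1) (by omega)).hom.app P ≫ (u ≫ δ)⟦(-1:ℤ)⟧' ≫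
      (shiftFunctorCompIsoId C (1:ℤ) (-1) (by omega)).hom.app X) (fun u v => by
        simp [Preadditive.add_comp, Preadditive.comp_add, Functor.map_add])
  app_smul {n k l} h m a := by
    simp only [AddMonoidHom.mk'_apply]
    show (shiftFunctorAdd' C l (-1) (l-1) (by omega)).hom.app P ≫
        ((gsmulHom P h m a) ≫ δ)⟦(-1:ℤ)⟧' ≫
          (shiftFunctorCompIsoId C (1:ℤ) (-1) (by omega)).hom.app X =
      gsmulHom P (show (n-1) + k = l - 1 by omega)
        ((shiftFunctorAdd' C n (-1) (n-1) (by omega)).hom.app P ≫ (m ≫ δ)⟦(-1:ℤ)⟧' ≫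
          (shiftFunctorCompIsoId C (1:ℤ) (-1) (by omega)).hom.app X) a
    simp only [gsmulHom, Functor.map_comp, Category.assoc]
    have nat := ((shiftFunctorAdd' C n (-1) (n-1) (by omega : n + -1 = n - 1)).hom).naturality a
    dsimp at nat
    rw [reassoc_of% nat]
    rw [shiftFunctorAdd'_assoc_hom_app_assoc k n (-1) l (n-1) (l-1) (by omega) (by omega)
      (by omega) P]

section ExtGroups

instance {P : C} {M N : GradedModule P} : Add (GHom M N) :=
  ⟨fun f g =>
    { app := fun n => f.app n + g.app n
      app_smul := fun {n k l} h m a => by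
        show f.app l _ + g.app l _ = N.smul h (f.app n m + g.app n m) a
        rw [f.app_smul, g.app_smul, N.add_smulₓ] }⟩

instance {P : C} {M N : GradedModule P} : Neg (GHom M N) :=
  ⟨fun f =>
    { app := fun n => -(f.app n)
      app_smul := fun {n k l} h m a => by
        show -(f.app l _) = N.smul h (-(f.app n m)) a
        rw [f.app_smul]
        exact (map_neg (N.smulAddHom h a) _).symm }⟩

@[simp] theorem GHom.add_app {P : C} {M N : GradedModule P} (f g : GHom M N) (n : ℤ)
    (x : M.M n) : (f + g).app n x = f.app n x + g.app n x := rfl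

@[simp] theorem GHom.neg_app {P : C} {M N : GradedModule P} (f : GHom M N) (n : ℤ)
    (x : M.M n) : (-f).app n x = -(f.app n x) := rfl

instance {P : C} {M N : GradedModule P} : AddCommGroup (GHom M N) where
  add := (· + ·)
  zero := 0
  neg := Neg.neg
  add_assoc f g h := by ext n x; simp [add_assoc]
  zero_add f := by ext n x; simp
  add_zero f := by ext n x; simp
  add_comm f g := by ext n x; simp [add_comm]
  neg_add_cancel f := by ext n x; simp
  nsmul := nsmulRec
  zsmul := zsmulRec

/-- A projective resolution `⋯ → F₂ → F₁ → F₀ → B → 0` of a graded right `Λ`-module. -/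
structure ProjResolution {P : C} (B : GradedModule P) where
  F : ℕ → GradedModule P
  d : ∀ i : ℕ, GHom (F (i + 1)) (F i)
  aug : GHom (F 0) B
  projective : ∀ i, IsProjective (F i)
  aug_surjective : ∀ n : ℤ, Function.Surjective (aug.app n)
  exact_aug : ∀ (n : ℤ) (x : (F 0).M n), aug.app n x = 0 ↔ x ∈ Set.range ((d 0).app n)
  exact_d : ∀ (i : ℕ) (n : ℤ) (x : (F (i + 1)).M n),
    (d i).app n x = 0 ↔ x ∈ Set.range ((d (i + 1)).app n)

/-- The differential of the cochain complex `Hom_Λ(F_•, Z)` obtained by applying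
`Hom_Λ(−, Z)` to a projective resolution `F_•`. -/
def cochainD {P : C} {B : GradedModule P} (R : ProjResolution B) (Z : GradedModule P)
    (i : ℕ) : GHom (R.F i) Z →+ GHom (R.F (i + 1)) Z :=
  AddMonoidHom.mk' (fun f => f.comp (R.d i)) (fun f g => by ext n x; rfl)

/-- `Ext^{j+1}_Λ(B, Z)`, computed as the `(j+1)`-st cohomology
`ker(Hom(F_{j+1}, Z) → Hom(F_{j+2}, Z)) / im(Hom(F_j, Z) → Hom(F_{j+1}, Z))`
of the complex `Hom_Λ(F_•, Z)` for a projective resolution `F_• → B`. -/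
def extGroup {P : C} {B : GradedModule P} (R : ProjResolution B) (Z : GradedModule P)
    (j : ℕ) : Type v :=
  AddMonoidHom.ker (cochainD R Z (j + 1)) ⧸
    (AddMonoidHom.range (cochainD R Z j)).addSubgroupOf
      (AddMonoidHom.ker (cochainD R Z (j + 1)))

noncomputable instance {P : C} {B : GradedModule P} (R : ProjResolution B)
    (Z : GradedModule P) (j : ℕ) : AddCommGroup (extGroup R Z j) := by
  dsimp [extGroup]; infer_instance

end ExtGroups
section DG

/-- A differential graded right module over `Λ = End_T(P)_*`, where `Λ` is regarded as a
DG ring with zero differential: a graded right `Λ`-module together with a square-zero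
`Λ`-linear differential of degree `-1`. -/
structure DGMod (P : C) where
  gm : GradedModule P
  d : ∀ {n m : ℤ}, m + 1 = n → (gm.M n →+ gm.M m)
  d_sq : ∀ {n m j : ℤ} (h : m + 1 = n) (h' : j + 1 = m) (x : gm.M n), d h' (d h x) = 0
  d_smul : ∀ {n m j l l' : ℤ} (h : m + 1 = n) (hl : n + j = l) (hl' : l' + 1 = l)
    (hm : m + j = l') (x : gm.M n) (a : lam P j),
    d hl' (gm.smul hl x a) = gm.smul hm (d h x) a

/-- A morphism of DG `Λ`-modules: a morphism of the underlying graded modules commuting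
with the differentials. -/
structure DGHom {P : C} (M N : DGMod P) where
  g : GHom M.gm N.gm
  comm : ∀ {n m : ℤ} (h : m + 1 = n) (x : M.gm.M n),
    g.app m (M.d h x) = N.d h (g.app n x)

@[ext] theorem DGHom.ext {P : C} {M N : DGMod P} {f f' : DGHom M N}
    (h : ∀ (n : ℤ) (x : M.gm.M n), f.g.app n x = f'.g.app n x) : f = f' := by
  obtain ⟨fg, _⟩ := f; obtain ⟨fg', _⟩ := f'
  congr 1
  exact GHom.ext h

/-- The category of differential graded right `Λ`-modules. -/
instance dgModCategory (P : C) : Category (DGMod P) where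
  Hom M N := DGHom M N
  id M := ⟨GHom.id _, fun _ _ => rfl⟩
  comp f g := ⟨g.g.comp f.g, fun h x => by
    show g.g.app _ (f.g.app _ _) = _
    rw [f.comm, g.comm]
    rfl⟩
  id_comp f := by apply DGHom.ext; intros; rfl
  comp_id f := by apply DGHom.ext; intros; rfl
  assoc f g h := by apply DGHom.ext; intros; rfl

/-- The cycles `ker dₙ` of a DG module in degree `n`. -/
abbrev cycles {P : C} (M : DGMod P) (n : ℤ) : AddSubgroup (M.gm.M n) :=
  AddMonoidHom.ker (M.d (n := n) (m := n - 1) (by omega))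

/-- The boundaries `im d_{n+1}` of a DG module in degree `n`. -/
abbrev boundaries {P : C} (M : DGMod P) (n : ℤ) : AddSubgroup (M.gm.M n) :=
  AddMonoidHom.range (M.d (n := n + 1) (m := n) rfl)

/-- The homology `H_n M = ker dₙ / im d_{n+1}` of a DG module. -/
abbrev dgHomology {P : C} (M : DGMod P) (n : ℤ) : Type v :=
  cycles M n ⧸ (boundaries M n).addSubgroupOf (cycles M n)

/-- The map induced on cycles by a morphism of DG modules. -/
def cyclesMap {P : C} {M N : DGMod P} (f : M ⟶ N) (n : ℤ) : cycles M n →+ cycles N n :=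
  AddMonoidHom.codRestrict ((f.g.app n).comp (cycles M n).subtype) _ (fun x => by
    have hx : M.d (show (n - 1) + 1 = n by omega) x.1 = 0 := x.2
    have : N.d (show (n - 1) + 1 = n by omega) (f.g.app n x.1) = 0 := by
      rw [← f.comm (show (n - 1) + 1 = n by omega), hx, map_zero]
    exact this)

/-- The map induced on homology by a morphism of DG modules. -/
def dgHomologyMap {P : C} {M N : DGMod P} (f : M ⟶ N) (n : ℤ) :
    dgHomology M n →+ dgHomology N n :=
  QuotientAddGroup.map _ _ (cyclesMap f n) (by
    intro x hx
    have hx' : x.1 ∈ boundaries M n := hx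
    obtain ⟨y, hy⟩ := AddMonoidHom.mem_range.mp hx'
    have : (f.g.app n x.1) ∈ boundaries N n := by
      refine AddMonoidHom.mem_range.mpr ⟨f.g.app (n + 1) y, ?_⟩
      rw [← f.comm rfl y, hy]
    exact this)

/-- A quasi-isomorphism of DG modules: a morphism inducing an isomorphism on homology. -/
def quasiIso (P : C) : MorphismProperty (DGMod P) :=
  fun _ _ f => ∀ n : ℤ, Function.Bijective (dgHomologyMap f n)

/-- The derived category `D(Λ)` of the graded endomorphism ring `Λ = End_T(P)_*`
(regarded as a DG ring with zero differential): the localization of the category of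
DG right `Λ`-modules at the quasi-isomorphisms. -/
abbrev DerivedCat (P : C) := (quasiIso P).Localization

end DG


section ModuleAlgebra

variable {P : C}

theorem GHom.congr_app {M N : GradedModule P} {f g : GHom M N} (h : f = g) (n : ℤ)
    (x : M.M n) : f.app n x = g.app n x := by rw [h]

@[simp] theorem GHom.comp_app {M N K : GradedModule P} (g : GHom N K) (f : GHom M N) (n : ℤ)
    (x : M.M n) : (g.comp f).app n x = g.app n (f.app n x) := rfl

@[simp] theorem GHom.id_app {M : GradedModule P} (n : ℤ) (x : M.M n) :
    (GHom.id M).app n x = x := rfl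

@[simp] theorem GHom.sub_app {M N : GradedModule P} (f g : GHom M N) (n : ℤ) (x : M.M n) :
    (f - g).app n x = f.app n x - g.app n x := by
  rw [sub_eq_add_neg, GHom.add_app, GHom.neg_app, sub_eq_add_neg]

@[simp] theorem cochainD_app {B : GradedModule P} (R : ProjResolution B) (Z : GradedModule P)
    (i : ℕ) (f : GHom (R.F i) Z) : cochainD R Z i f = f.comp (R.d i) := rfl

/-- A morphism whose values lie in the range of a degreewise injective morphism factors
through it. -/
theorem GHom.exists_lift {K F G : GradedModule P} (ι : GHom K F)
    (hι : ∀ n, Function.Injective (ι.app n)) (φ : GHom G F)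
    (hφ : ∀ n x, φ.app n x ∈ Set.range (ι.app n)) :
    ∃ ψ : GHom G K, ∀ n x, ι.app n (ψ.app n x) = φ.app n x := by
  choose ψ hψ using hφ
  refine ⟨⟨fun n => AddMonoidHom.mk' (ψ n) fun x y => ?_, fun h m a => ?_⟩, fun n x => hψ n x⟩
  · exact hι n (by simp [hψ])
  · exact hι _ (by simp [hψ, ι.app_smul, φ.app_smul])

/-- A degreewise bijective morphism has an inverse. -/
theorem GHom.exists_inverse {M N : GradedModule P} (f : GHom M N)
    (hf : ∀ n, Function.Bijective (f.app n)) :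
    ∃ g : GHom N M, f.comp g = GHom.id N ∧ g.comp f = GHom.id M := by
  obtain ⟨g, hg⟩ := f.exists_lift (fun n => (hf n).1) (GHom.id N) (fun n x => (hf n).2 x)
  refine ⟨g, GHom.ext fun n x => hg n x, GHom.ext fun n x => (hf n).1 ?_⟩
  simp [hg]

theorem IsProjective.of_decomposition {M A G : GradedModule P} (hA : IsProjective A)
    (hG : IsProjective G) (s₁ : GHom M A) (r₁ : GHom A M) (s₂ : GHom M G) (r₂ : GHom G M)
    (h : ∀ n x, r₁.app n (s₁.app n x) + r₂.app n (s₂.app n x) = x) : IsProjective M := by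
  intro U V e he f
  obtain ⟨g₁, hg₁⟩ := hA U V e he (f.comp r₁)
  obtain ⟨g₂, hg₂⟩ := hG U V e he (f.comp r₂)
  refine ⟨g₁.comp s₁ + g₂.comp s₂, GHom.ext fun n x => ?_⟩
  have h₁ := GHom.congr_app hg₁ n (s₁.app n x)
  have h₂ := GHom.congr_app hg₂ n (s₂.app n x)
  simp only [GHom.comp_app] at h₁ h₂
  simp only [GHom.comp_app, GHom.add_app, map_add, h₁, h₂]
  rw [← map_add, h]

theorem IsProjective.of_retract {M A : GradedModule P} (hA : IsProjective A)
    (s : GHom M A) (r : GHom A M) (h : ∀ n x, r.app n (s.app n x) = x) : IsProjective M :=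
  hA.of_decomposition hA s r 0 0 fun n x => by simp [h]

/-- Every iterated syzygy of order `d`, with respect to any choice of projective covers, is
projective. -/
def SyzygiesProjective : ℕ → GradedModule P → Prop
  | 0, M => IsProjective M
  | d + 1, M => ∀ (F K : GradedModule P) (ε : GHom F M) (ι : GHom K F),
      IsProjective F → IsShortExact ι ε → SyzygiesProjective d K

/-- If `M` is a retract of `A ⊕ G` with `G` projective and `A` has projective dimension at most
`d`, then all syzygies of `M` of order `d` are projective. -/
theorem projDimLE.syzygiesProjective_of_decomposition {d : ℕ} :
    ∀ {M A G : GradedModule P}, projDimLE d A → IsProjective G →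
      ∀ (s₁ : GHom M A) (r₁ : GHom A M) (s₂ : GHom M G) (r₂ : GHom G M),
      (∀ n x, r₁.app n (s₁.app n x) + r₂.app n (s₂.app n x) = x) →
      SyzygiesProjective d M := by
  induction d with
  | zero =>
    intro M A G hA hG s₁ r₁ s₂ r₂ h
    exact IsProjective.of_decomposition hA hG s₁ r₁ s₂ r₂ h
  | succ d ih =>
    intro M A G hA hG s₁ r₁ s₂ r₂ h F' K' ε' ι' hF' hS'
    obtain ⟨F, K, ε, ι, hF, hS, hK⟩ := hA
    obtain ⟨α₁, hα₁⟩ := hF' F A ε hS.epi (s₁.comp ε')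
    obtain ⟨β₁, hβ₁⟩ := hF F' M ε' hS'.epi (r₁.comp ε)
    obtain ⟨β₂, hβ₂⟩ := hG F' M ε' hS'.epi r₂
    replace hα₁ := fun n x => GHom.congr_app hα₁ n x
    replace hβ₁ := fun n x => GHom.congr_app hβ₁ n x
    replace hβ₂ := fun n x => GHom.congr_app hβ₂ n x
    simp only [GHom.comp_app] at hα₁ hβ₁ hβ₂
    have hι : ∀ n x, ε.app n (ι.app n x) = 0 := fun n x => (hS.exact n _).2 ⟨x, rfl⟩
    have hι' : ∀ n x, ε'.app n (ι'.app n x) = 0 := fun n x => (hS'.exact n _).2 ⟨x, rfl⟩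
    obtain ⟨σ, hσ⟩ := ι.exists_lift hS.mono (α₁.comp ι') fun n x =>
      (hS.exact n _).1 (by simp [hα₁, hι'])
    obtain ⟨ρ, hρ⟩ := ι'.exists_lift hS'.mono (β₁.comp ι) fun n x =>
      (hS'.exact n _).1 (by simp [hβ₁, hι])
    obtain ⟨τ, hτ⟩ := ι'.exists_lift hS'.mono
      (GHom.id F' - β₁.comp α₁ - (β₂.comp s₂).comp ε') fun n x =>
      (hS'.exact n _).1 (by
        simp only [GHom.comp_app, GHom.sub_app, GHom.id_app, map_sub, hβ₁, hα₁, hβ₂]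
        rw [sub_sub, h, sub_self])
    refine ih hK hF' σ ρ ι' τ fun n x => hS'.mono n ?_
    rw [map_add, hρ, hτ]
    simp only [GHom.comp_app] at hσ
    simp [hσ, hι']

theorem projDimLE.syzygiesProjective {d : ℕ} {M : GradedModule P} (h : projDimLE d M) :
    SyzygiesProjective d M := by
  have hG : ∃ G : GradedModule P, IsProjective G := by
    cases d with
    | zero => exact ⟨M, h⟩
    | succ d =>
      obtain ⟨F, _, _, _, hF, _⟩ := h
      exact ⟨F, hF⟩
  obtain ⟨G, hG⟩ := hG
  exact h.syzygiesProjective_of_decomposition hG (GHom.id M) (GHom.id M) 0 0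
    fun n x => by simp

/-- Two surjections from a group with the same kernel have isomorphic targets. -/
theorem nonempty_addEquiv_of_ker_eq {A B D : Type*} [AddCommGroup A] [AddCommGroup B]
    [AddCommGroup D] (f : A →+ B) (g : A →+ D) (hf : Function.Surjective f)
    (hg : Function.Surjective g) (h : ∀ a, f a = 0 ↔ g a = 0) : Nonempty (B ≃+ D) := by
  have hk : f.ker = g.ker := by ext a; exact h a
  exact ⟨(QuotientAddGroup.quotientKerEquivOfSurjective f hf).symm.trans
    ((QuotientAddGroup.quotientAddEquivOfEq hk).trans
      (QuotientAddGroup.quotientKerEquivOfSurjective g hg))⟩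

/-- The projection from cocycles onto the `Ext` group. -/
noncomputable def extGroupMk {B : GradedModule P} (R : ProjResolution B) (Z : GradedModule P)
    (j : ℕ) : AddMonoidHom.ker (cochainD R Z (j + 1)) →+ extGroup R Z j :=
  QuotientAddGroup.mk' _

theorem extGroupMk_surjective {B : GradedModule P} (R : ProjResolution B) (Z : GradedModule P)
    (j : ℕ) : Function.Surjective (extGroupMk R Z j) :=
  QuotientAddGroup.mk'_surjective _

theorem extGroupMk_eq_zero_iff {B : GradedModule P} (R : ProjResolution B)
    (Z : GradedModule P) (j : ℕ) (x : AddMonoidHom.ker (cochainD R Z (j + 1))) :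
    extGroupMk R Z j x = 0 ↔ ∃ t : GHom (R.F j) Z, t.comp (R.d j) = x.1 := by
  refine (QuotientAddGroup.eq_zero_iff x).trans ?_
  rw [AddSubgroup.mem_addSubgroupOf]
  rfl

/-- An isomorphism of the cochain complexes computing `Ext` induces an isomorphism on `Ext`. -/
theorem nonempty_extGroup_addEquiv {B B' : GradedModule P} (R : ProjResolution B)
    (R' : ProjResolution B') (Z : GradedModule P)
    (e : ∀ k, GHom (R.F k) Z →+ GHom (R'.F k) Z) (he : ∀ k, Function.Bijective (e k))
    (hd : ∀ k f, e (k + 1) (f.comp (R.d k)) = (e k f).comp (R'.d k)) (j : ℕ) :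
    Nonempty (extGroup R Z j ≃+ extGroup R' Z j) := by
  have hker : ∀ f : GHom (R.F (j + 1)) Z, f ∈ AddMonoidHom.ker (cochainD R Z (j + 1)) ↔
      e (j + 1) f ∈ AddMonoidHom.ker (cochainD R' Z (j + 1)) := by
    intro f
    rw [AddMonoidHom.mem_ker, AddMonoidHom.mem_ker, cochainD_app, cochainD_app, ← hd,
      map_eq_zero_iff _ (he _).1]
  let E : AddMonoidHom.ker (cochainD R Z (j + 1)) →+ AddMonoidHom.ker (cochainD R' Z (j + 1)) :=
    ((e (j + 1)).comp (AddSubgroup.subtype _)).codRestrict _ fun f => (hker f.1).1 f.2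
  have hE : ∀ f, (E f).1 = e (j + 1) f.1 := fun f => rfl
  refine nonempty_addEquiv_of_ker_eq (extGroupMk R Z j) ((extGroupMk R' Z j).comp E)
    (extGroupMk_surjective R Z j) ((extGroupMk_surjective R' Z j).comp ?_) fun x => ?_
  · rintro ⟨y, hy⟩
    obtain ⟨x, rfl⟩ := (he _).2 y
    exact ⟨⟨x, (hker x).2 hy⟩, Subtype.ext rfl⟩
  · rw [AddMonoidHom.comp_apply, extGroupMk_eq_zero_iff, extGroupMk_eq_zero_iff, hE]
    constructor
    · rintro ⟨t, ht⟩
      exact ⟨e j t, by rw [← hd, ht]⟩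
    · rintro ⟨t, ht⟩
      obtain ⟨t, rfl⟩ := (he _).2 t
      exact ⟨t, (he _).1 (by rw [hd, ht])⟩

/-- Replace the augmentation of a projective resolution. -/
def ProjResolution.withAug {B B' : GradedModule P} (R : ProjResolution B)
    (aug : GHom (R.F 0) B') (h₁ : ∀ n, Function.Surjective (aug.app n))
    (h₂ : ∀ (n : ℤ) (x : (R.F 0).M n), aug.app n x = 0 ↔ x ∈ Set.range ((R.d 0).app n)) :
    ProjResolution B' :=
  { R with aug := aug, aug_surjective := h₁, exact_aug := h₂ }

/-- The projective resolution of the first syzygy obtained by dropping the first term. -/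
def ProjResolution.tail {B B' : GradedModule P} (R : ProjResolution B)
    (aug : GHom (R.F 1) B') (h₁ : ∀ n, Function.Surjective (aug.app n))
    (h₂ : ∀ (n : ℤ) (x : (R.F 1).M n), aug.app n x = 0 ↔ x ∈ Set.range ((R.d 1).app n)) :
    ProjResolution B' where
  F k := R.F (k + 1)
  d k := R.d (k + 1)
  aug := aug
  projective k := R.projective (k + 1)
  aug_surjective := h₁
  exact_aug := h₂
  exact_d k := R.exact_d (k + 1)

section Truncation

variable {N : ℕ}

/-- The elements of degree `n` that vanish unless `n` is congruent to `i` modulo `N`. -/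
def degreeSubgroup (N : ℕ) (i : ZMod N) (M : GradedModule P) (n : ℤ) : AddSubgroup (M.M n) where
  carrier := { x | (n : ZMod N) ≠ i → x = 0 }
  zero_mem' := fun _ => rfl
  add_mem' := fun hx hy hn => by rw [hx hn, hy hn, add_zero]
  neg_mem' := fun hx hn => by rw [hx hn, neg_zero]

theorem GradedModule.smul_zeroₓ (M : GradedModule P) {n k l : ℤ} (h : n + k = l) (m : M.M n) :
    M.smul h m (0 : lam P k) = 0 := by
  have h0 := M.smul_addₓ h m 0 0
  rw [add_zero] at h0
  exact left_eq_add.1 h0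

/-- In a module over an `N`-sparse ring, the action between degrees with different residues
modulo `N` vanishes. -/
theorem Sparse.smul_eq_zero (hsp : Sparse P N) (M : GradedModule P) {n k l : ℤ} (h : n + k = l)
    (hnl : (n : ZMod N) ≠ l) (m : M.M n) (a : lam P k) : M.smul h m a = 0 := by
  have ha : a = 0 := hsp k (fun hk => hnl (by
    rw [← h, Int.cast_add, (ZMod.intCast_zmod_eq_zero_iff_dvd k N).2 hk, add_zero])) a
  rw [ha, M.smul_zeroₓ]

/-- The part of a graded module in degrees congruent to `i` modulo `N`. -/
def degreePart (hsp : Sparse P N) (i : ZMod N) (M : GradedModule P) : GradedModule P where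
  M n := degreeSubgroup N i M n
  smul {n k l} h x a := ⟨M.smul h x.1 a, fun hl => by
    by_cases hn : (n : ZMod N) = i
    · exact hsp.smul_eq_zero M h (fun hnl => hl (hnl ▸ hn)) _ _
    · rw [x.2 hn, M.zero_smulₓ]⟩
  smul_addₓ h m a b := Subtype.ext (M.smul_addₓ h m.1 a b)
  add_smulₓ h m m' a := Subtype.ext (M.add_smulₓ h m.1 m'.1 a)
  smul_oneₓ m := Subtype.ext (M.smul_oneₓ m.1)
  smul_mulₓ h₁ h₂ h₃ h₄ m a b := Subtype.ext (M.smul_mulₓ h₁ h₂ h₃ h₄ m.1 a b)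

theorem inDegrees_degreePart (hsp : Sparse P N) (i : ZMod N) (M : GradedModule P) :
    InDegrees N i (degreePart hsp i M) :=
  fun _ hn x => Subtype.ext (x.2 hn)

/-- The inclusion of the part of a graded module in degrees congruent to `i`. -/
def degreePartι (hsp : Sparse P N) (i : ZMod N) (M : GradedModule P) :
    GHom (degreePart hsp i M) M where
  app n := (degreeSubgroup N i M n).subtype
  app_smul _ _ _ := rfl

theorem degreePartι_injective (hsp : Sparse P N) (i : ZMod N) (M : GradedModule P) (n : ℤ) :
    Function.Injective ((degreePartι hsp i M).app n) :=
  Subtype.val_injective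

theorem mem_range_degreePartι_iff (hsp : Sparse P N) (i : ZMod N) (M : GradedModule P) (n : ℤ)
    (x : M.M n) :
    x ∈ Set.range ((degreePartι hsp i M).app n) ↔ ((n : ZMod N) ≠ i → x = 0) :=
  ⟨fun ⟨y, hy⟩ hn => by rw [← hy]; exact y.2 hn, fun h => ⟨⟨x, h⟩, rfl⟩⟩

open Classical in
/-- The projection onto the part of a graded module in degrees congruent to `i`, as an
endomorphism. -/
noncomputable def degreeProj (hsp : Sparse P N) (i : ZMod N) (M : GradedModule P) :
    GHom M M where
  app n := if (n : ZMod N) = i then AddMonoidHom.id _ else 0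
  app_smul {n k l} h m a := by
    by_cases hn : (n : ZMod N) = i <;> by_cases hl : (l : ZMod N) = i
    · simp [hn, hl]
    · simp [hn, hl, hsp.smul_eq_zero M h (fun e => hl (e ▸ hn)) m a]
    · simp [hn, hl, hsp.smul_eq_zero M h (fun e => hn (e ▸ hl)) m a, M.zero_smulₓ]
    · simp [hn, hl, M.zero_smulₓ]

theorem exists_degreePartπ (hsp : Sparse P N) (i : ZMod N) (M : GradedModule P) :
    ∃ π : GHom M (degreePart hsp i M), ∀ n x, (degreePartι hsp i M).app n (π.app n x) =
      (degreeProj hsp i M).app n x :=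
  (degreePartι hsp i M).exists_lift (degreePartι_injective hsp i M) (degreeProj hsp i M)
    fun n x => (mem_range_degreePartι_iff hsp i M n _).2 fun hn => by simp [degreeProj, hn]

theorem degreeProj_eq_zero (hsp : Sparse P N) (i : ZMod N) (M : GradedModule P) {n : ℤ}
    (hn : (n : ZMod N) ≠ i) (x : M.M n) : (degreeProj hsp i M).app n x = 0 := by
  simp [degreeProj, hn]

theorem degreeProj_eq_self (hsp : Sparse P N) (i : ZMod N) (M : GradedModule P) {n : ℤ}
    (hn : (n : ZMod N) = i) (x : M.M n) : (degreeProj hsp i M).app n x = x := by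
  simp [degreeProj, hn]

theorem degreeProj_naturality (hsp : Sparse P N) (i : ZMod N) {M M' : GradedModule P}
    (f : GHom M M') (n : ℤ) (x : M.M n) :
    f.app n ((degreeProj hsp i M).app n x) = (degreeProj hsp i M').app n (f.app n x) := by
  by_cases hn : (n : ZMod N) = i
  · rw [degreeProj_eq_self _ _ _ hn, degreeProj_eq_self _ _ _ hn]
  · rw [degreeProj_eq_zero _ _ _ hn, degreeProj_eq_zero _ _ _ hn, map_zero]

/-- The projection onto the part of a graded module in degrees congruent to `i`. -/
noncomputable def degreePartπ (hsp : Sparse P N) (i : ZMod N) (M : GradedModule P) :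
    GHom M (degreePart hsp i M) :=
  (exists_degreePartπ hsp i M).choose

theorem degreePartι_π (hsp : Sparse P N) (i : ZMod N) (M : GradedModule P) (n : ℤ) (x : M.M n) :
    (degreePartι hsp i M).app n ((degreePartπ hsp i M).app n x) =
      (degreeProj hsp i M).app n x :=
  (exists_degreePartπ hsp i M).choose_spec n x

theorem degreeProj_degreePartι (hsp : Sparse P N) (i : ZMod N) (M : GradedModule P) (n : ℤ)
    (x : (degreePart hsp i M).M n) :
    (degreeProj hsp i M).app n ((degreePartι hsp i M).app n x) =
      (degreePartι hsp i M).app n x := by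
  by_cases hn : (n : ZMod N) = i
  · rw [degreeProj_eq_self _ _ _ hn]
  · rw [degreeProj_eq_zero _ _ _ hn, inDegrees_degreePart hsp i M n hn x, map_zero]

theorem degreePartπ_ι (hsp : Sparse P N) (i : ZMod N) (M : GradedModule P) (n : ℤ)
    (x : (degreePart hsp i M).M n) :
    (degreePartπ hsp i M).app n ((degreePartι hsp i M).app n x) = x :=
  degreePartι_injective hsp i M n (by rw [degreePartι_π, degreeProj_degreePartι])

/-- The morphism induced on the parts in degrees congruent to `i`. -/
noncomputable def degreePartMap (hsp : Sparse P N) (i : ZMod N) {M M' : GradedModule P}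
    (f : GHom M M') : GHom (degreePart hsp i M) (degreePart hsp i M') :=
  (degreePartπ hsp i M').comp (f.comp (degreePartι hsp i M))

theorem degreePartι_map (hsp : Sparse P N) (i : ZMod N) {M M' : GradedModule P}
    (f : GHom M M') (n : ℤ) (x : (degreePart hsp i M).M n) :
    (degreePartι hsp i M').app n ((degreePartMap hsp i f).app n x) =
      f.app n ((degreePartι hsp i M).app n x) := by
  simp only [degreePartMap, GHom.comp_app]
  rw [degreePartι_π, ← degreeProj_naturality, degreeProj_degreePartι]

/-- An element of the truncation lies in the image of the truncated morphism if and only if it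
lies in the image of the untruncated one. -/
theorem mem_range_degreePartMap_iff (hsp : Sparse P N) (i : ZMod N) {M M' : GradedModule P}
    (f : GHom M M') (n : ℤ) (x : (degreePart hsp i M').M n) :
    x ∈ Set.range ((degreePartMap hsp i f).app n) ↔
      (degreePartι hsp i M').app n x ∈ Set.range (f.app n) := by
  constructor
  · rintro ⟨y, rfl⟩
    exact ⟨_, (degreePartι_map hsp i f n y).symm⟩
  · rintro ⟨y, hy⟩
    refine ⟨(degreePartπ hsp i M).app n y, degreePartι_injective hsp i M' n ?_⟩
    rw [degreePartι_map, degreePartι_π, degreeProj_naturality, hy, degreeProj_degreePartι]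

/-- A projective resolution of a module concentrated in degrees congruent to `i` can be
truncated to those degrees. -/
noncomputable def ProjResolution.degreePart (hsp : Sparse P N) (i : ZMod N)
    {B : GradedModule P} (hB : InDegrees N i B) (R : ProjResolution B) : ProjResolution B where
  F k := Franke.degreePart hsp i (R.F k)
  d k := degreePartMap hsp i (R.d k)
  aug := R.aug.comp (degreePartι hsp i (R.F 0))
  projective k := (R.projective k).of_retract (degreePartι hsp i _) (degreePartπ hsp i _)
    (degreePartπ_ι hsp i _)
  aug_surjective n b := by
    by_cases hn : (n : ZMod N) = i
    · obtain ⟨x, hx⟩ := R.aug_surjective n b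
      refine ⟨(degreePartπ hsp i _).app n x, ?_⟩
      rw [GHom.comp_app, degreePartι_π, degreeProj_eq_self _ _ _ hn, hx]
    · exact ⟨0, by rw [map_zero, hB n hn b]⟩
  exact_aug n x := by
    rw [mem_range_degreePartMap_iff, ← R.exact_aug, GHom.comp_app]
  exact_d k n x := by
    rw [mem_range_degreePartMap_iff, ← R.exact_d, ← degreePartι_map,
      map_eq_zero_iff _ (degreePartι_injective hsp i _ n)]

theorem nonempty_extGroup_degreePart_addEquiv (hsp : Sparse P N) (i : ZMod N)
    {B : GradedModule P} (hB : InDegrees N i B) (R : ProjResolution B) (Z : GradedModule P)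
    (hZ : InDegrees N i Z) (j : ℕ) :
    Nonempty (extGroup R Z j ≃+ extGroup (R.degreePart hsp i hB) Z j) := by
  refine nonempty_extGroup_addEquiv R (R.degreePart hsp i hB) Z
    (fun k => AddMonoidHom.mk' (fun f => f.comp (degreePartι hsp i (R.F k)))
      (fun f g => GHom.ext fun n x => rfl)) (fun k => ⟨fun f g hfg => ?_, fun g => ?_⟩)
    (fun k f => GHom.ext fun n x => ?_) j
  · refine GHom.ext fun n x => ?_
    by_cases hn : (n : ZMod N) = i
    · have h := GHom.congr_app hfg n ((degreePartπ hsp i _).app n x)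
      change f.app n ((degreePartι hsp i (R.F k)).app n _) =
        g.app n ((degreePartι hsp i (R.F k)).app n _) at h
      rwa [degreePartι_π, degreeProj_eq_self _ _ _ hn] at h
    · rw [hZ n hn (f.app n x), hZ n hn (g.app n x)]
  · refine ⟨g.comp (degreePartπ hsp i (R.F k)), GHom.ext fun n x => ?_⟩
    exact congrArg (g.app n) (degreePartπ_ι hsp i (R.F k) n x)
  · exact congrArg (f.app n) (degreePartι_map hsp i (R.d k) n x).symm

end Truncation

end ModuleAlgebra

section Shifts

/-- Every morphism `P⟦m + k⟧ ⟶ Z⟦k⟧` is the suspension of a morphism `P⟦m⟧ ⟶ Z`. -/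
theorem exists_desuspension (P : C) {n k m : ℤ} (h : m + k = n) {Z : C} (u : P⟦n⟧ ⟶ Z⟦k⟧) :
    ∃ w : P⟦m⟧ ⟶ Z, (shiftFunctorAdd' C m k n h).hom.app P ≫ w⟦k⟧' = u := by
  obtain ⟨w, hw⟩ := (shiftFunctor C k).map_surjective ((shiftFunctorAdd' C m k n h).inv.app P ≫ u)
  exact ⟨w, by rw [hw, Iso.hom_inv_id_app_assoc]⟩

theorem desuspension_injective (P : C) {n k m : ℤ} (h : m + k = n) {Z : C} {w w' : P⟦m⟧ ⟶ Z}
    (hw : (shiftFunctorAdd' C m k n h).hom.app P ≫ w⟦k⟧' =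
      (shiftFunctorAdd' C m k n h).hom.app P ≫ w'⟦k⟧') : w = w' :=
  (shiftFunctor C k).map_injective ((cancel_epi _).1 hw)

/-- The morphism `(π_* X)[k] → π_* (X⟦k⟧)`. -/
def suspensionGHom (P X : C) (k : ℤ) : GHom (gshift k (piMod P X)) (piMod P (X⟦k⟧)) where
  app n := AddMonoidHom.mk' (fun u : P⟦n - k⟧ ⟶ X =>
    (shiftFunctorAdd' C (n - k) k n (by omega)).hom.app P ≫ u⟦k⟧')
    fun u v => by simp [Functor.map_add, Preadditive.comp_add]
  app_smul {n j l} h m a := by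
    change (shiftFunctorAdd' C (l - k) k l (by omega)).hom.app P ≫
      (gsmulHom P (show (n - k) + j = l - k by omega) m a)⟦k⟧' =
      gsmulHom P h ((shiftFunctorAdd' C (n - k) k n (by omega)).hom.app P ≫ m⟦k⟧') a
    simp only [gsmulHom, Functor.map_comp]
    have nat := ((shiftFunctorAdd' C (n - k) k n (by omega)).hom).naturality a
    dsimp at nat
    rw [reassoc_of% nat]
    rw [shiftFunctorAdd'_assoc_hom_app_assoc j (n - k) k (l - k) n l (by omega) (by omega)
      (by omega) P]

theorem suspensionGHom_bijective (P X : C) (k n : ℤ) :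
    Function.Bijective ((suspensionGHom P X k).app n) :=
  ⟨fun _ _ h => desuspension_injective P (by omega) h,
    fun u => exists_desuspension P (by omega) u⟩

end Shifts

section Yoneda

variable {P : C}

theorem exists_gsmulHom_id (P : C) {m n k : ℤ} (h : m + k = n) (u : P⟦n⟧ ⟶ P⟦m⟧) :
    ∃ a : lam P k, gsmulHom P h (𝟙 (P⟦m⟧)) a = u := by
  obtain ⟨a, ha⟩ := exists_desuspension P (show k + m = n by omega) u
  exact ⟨a, by rw [gsmulHom, Category.comp_id, ha]⟩

theorem gsmulHom_id_injective (P : C) {m n k : ℤ} (h : m + k = n) {a b : lam P k}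
    (hab : gsmulHom P h (𝟙 (P⟦m⟧)) a = gsmulHom P h (𝟙 (P⟦m⟧)) b) : a = b := by
  simp only [gsmulHom, Category.comp_id] at hab
  exact desuspension_injective P _ hab

/-- `π_* (P⟦m⟧)` is free on the identity of `P⟦m⟧`. -/
theorem exists_GHom_of_element (M : GradedModule P) {m : ℤ} (x : M.M m) :
    ∃ φ : GHom (piMod P (P⟦m⟧)) M, φ.app m (𝟙 (P⟦m⟧)) = x := by
  have key : ∀ n (u : P⟦n⟧ ⟶ P⟦m⟧), ∃ a : lam P (n - m),
      gsmulHom P (show m + (n - m) = n by omega) (𝟙 (P⟦m⟧)) a = u :=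
    fun n u => exists_gsmulHom_id P _ u
  choose a ha using key
  refine ⟨⟨fun n => AddMonoidHom.mk' (fun u => M.smul (by omega) x (a n u)) fun u v => ?_,
    fun {n k l} h u b => ?_⟩, ?_⟩
  · rw [← M.smul_addₓ]
    congr 1
    refine gsmulHom_id_injective P (show m + (n - m) = n by omega) ?_
    have h := (piMod P (P⟦m⟧)).smul_addₓ (show m + (n - m) = n by omega) (𝟙 (P⟦m⟧))
      (a n u) (a n v)
    refine (ha _ _).trans (Eq.trans ?_ h.symm)
    exact (congrArg₂ (· + ·) (ha n u) (ha n v)).symm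
  · change M.smul _ x (a l (gsmulHom P h u b)) = M.smul h (M.smul _ x (a n u)) b
    rw [M.smul_mulₓ _ (show (n - m) + k = l - m by omega) h (by omega)]
    congr 1
    refine gsmulHom_id_injective P (show m + (l - m) = l by omega) ?_
    have h' := (piMod P (P⟦m⟧)).smul_mulₓ (show m + (n - m) = n by omega)
      (show (n - m) + k = l - m by omega) h (by omega) (𝟙 (P⟦m⟧)) (a n u) b
    refine (ha _ _).trans (Eq.trans ?_ h')
    exact congrArg (fun v => gsmulHom P h v b) (ha n u).symm
  · change M.smul _ x (a m (𝟙 (P⟦m⟧))) = x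
    have e : ∀ {k : ℤ} (hk : m + k = m) (b : lam P k), gsmulHom P hk (𝟙 (P⟦m⟧)) b = 𝟙 (P⟦m⟧) →
        M.smul hk x b = x := by
      intro k hk b hb
      obtain rfl : k = 0 := by omega
      have : b = gone P := gsmulHom_id_injective P hk
        (hb.trans ((piMod P (P⟦m⟧)).smul_oneₓ (𝟙 (P⟦m⟧))).symm)
      rw [this, M.smul_oneₓ]
    exact e _ _ (ha m _)

/-- A morphism out of `π_* (P⟦m⟧)` is determined by the image of the identity. -/
theorem GHom.ext_of_id {M : GradedModule P} {m : ℤ} {φ ψ : GHom (piMod P (P⟦m⟧)) M}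
    (h : φ.app m (𝟙 (P⟦m⟧)) = ψ.app m (𝟙 (P⟦m⟧))) : φ = ψ := by
  refine GHom.ext fun n u => ?_
  obtain ⟨a, rfl⟩ := exists_gsmulHom_id P (show m + (n - m) = n by omega) u
  have h₁ := φ.app_smul (show m + (n - m) = n by omega) (𝟙 (P⟦m⟧)) a
  have h₂ := ψ.app_smul (show m + (n - m) = n by omega) (𝟙 (P⟦m⟧)) a
  rw [h] at h₁
  exact h₁.trans h₂.symm

end Yoneda

section Coproducts

variable [HasCoproducts.{v} C] {P : C}

open Classical in
/-- A compact object commutes with coproducts presented by any colimit cofan. -/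
theorem IsCompactObj.exists_addEquiv_of_isColimit (hP : IsCompactObj P) {ι : Type v} {X : ι → C}
    (c : Cofan X) (hc : IsColimit c) :
    ∃ e : (⨁ i, (P ⟶ X i)) ≃+ (P ⟶ c.pt),
      ∀ i f, e (DirectSum.of (fun i => P ⟶ X i) i f) = f ≫ c.inj i := by
  let φ : (∐ X) ≅ c.pt := (coproductIsCoproduct X).coconePointUniqueUpToIso hc
  have hφ : ∀ i, Sigma.ι X i ≫ φ.hom = c.inj i := fun i =>
    (coproductIsCoproduct X).comp_coconePointUniqueUpToIso_hom hc ⟨i⟩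
  let e₁ : (⨁ i, (P ⟶ X i)) ≃+ (P ⟶ ∐ X) := AddEquiv.ofBijective _ (hP ι X)
  let e₂ : (P ⟶ ∐ X) ≃+ (P ⟶ c.pt) :=
    { toFun := fun f => f ≫ φ.hom
      invFun := fun f => f ≫ φ.inv
      left_inv := fun f => by simp
      right_inv := fun f => by simp
      map_add' := fun f g => Preadditive.add_comp _ _ _ _ _ _ }
  refine ⟨e₁.trans e₂, fun i f => ?_⟩
  change compactComparison P X (DirectSum.of _ i f) ≫ φ.hom = _
  have h : compactComparison P X (DirectSum.of _ i f) = f ≫ Sigma.ι X i := by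
    unfold compactComparison
    exact DirectSum.toAddMonoid_of _ _ _
  rw [h, Category.assoc, hφ]

open Classical in
/-- Shifts of a compact object commute with coproducts. -/
theorem IsCompactObj.exists_addEquiv_shift (hP : IsCompactObj P) {ι : Type v} (X : ι → C)
    (n : ℤ) :
    ∃ e : (⨁ i, (P⟦n⟧ ⟶ X i)) ≃+ (P⟦n⟧ ⟶ ∐ X),
      ∀ i f, e (DirectSum.of (fun i => P⟦n⟧ ⟶ X i) i f) = f ≫ Sigma.ι X i := by
  let G := (shiftEquiv C n).inverse
  have : G.Additive := inferInstanceAs (shiftFunctor C (-n)).Additive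
  let adj := (shiftEquiv C n).toAdjunction
  have : (shiftEquiv C n).functor.Additive := inferInstanceAs (shiftFunctor C n).Additive
  let a : ∀ Z : C, (P⟦n⟧ ⟶ Z) ≃+ (P ⟶ G.obj Z) := fun Z => adj.homAddEquiv P Z
  have ha : ∀ {Z Z' : C} (g : Z ⟶ Z') (f : P⟦n⟧ ⟶ Z), a Z' (f ≫ g) = a Z f ≫ G.map g :=
    fun g f => adj.homEquiv_naturality_right f g
  let c : Cofan (fun i => G.obj (X i)) := Cofan.mk (G.obj (∐ X)) fun i => G.map (Sigma.ι X i)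
  have hc : IsColimit c := isColimitCofanMkObjOfIsColimit G _ _ (coproductIsCoproduct X)
  obtain ⟨e, he⟩ := hP.exists_addEquiv_of_isColimit c hc
  refine ⟨(DFinsupp.mapRange.addEquiv fun i => a (X i)).trans (e.trans (a (∐ X)).symm),
    fun i f => ?_⟩
  rw [AddEquiv.trans_apply, AddEquiv.trans_apply, AddEquiv.symm_apply_eq, ha]
  refine Eq.trans (congrArg e ?_) (he i (a (X i) f))
  exact DFinsupp.mapRange_single (hf := fun i => map_zero (a (X i)))

/-- A family of module morphisms extends to the homotopy of the coproduct. -/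
theorem exists_GHom_sigma (hP : IsCompactObj P) {ι : Type v} (X : ι → C) {M : GradedModule P}
    (g : ∀ i, GHom (piMod P (X i)) M) :
    ∃ φ : GHom (piMod P (∐ X)) M, ∀ i, φ.comp (piGHom P (Sigma.ι X i)) = g i := by
  classical
  choose e he using fun n => hP.exists_addEquiv_shift X n
  let φ : ∀ n, (P⟦n⟧ ⟶ ∐ X) →+ M.M n := fun n =>
    (DirectSum.toAddMonoid fun i => (g i).app n).comp (e n).symm.toAddMonoidHom
  have hφ : ∀ n i f, φ n (f ≫ Sigma.ι X i) = (g i).app n f := by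
    intro n i f
    rw [← he]
    simp [φ]
  refine ⟨⟨φ, fun {n k l} h u a => ?_⟩, fun i => GHom.ext fun n f => hφ n i f⟩
  obtain ⟨w, rfl⟩ := (e n).surjective u
  induction w using DirectSum.induction_on with
  | zero =>
    rw [map_zero, map_zero, M.zero_smulₓ]
    rw [GradedModule.zero_smulₓ, map_zero]
  | of i f =>
    rw [he, hφ, ← (g i).app_smul, ← hφ]
    congr 1
    exact ((piGHom P (Sigma.ι X i)).app_smul h f a).symm
  | add x y hx hy =>
    have hxy : (piMod P (∐ X)).smul h (e n (x + y)) a =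
        (piMod P (∐ X)).smul h (e n x) a + (piMod P (∐ X)).smul h (e n y) a :=
      (congrArg (fun z => gsmulHom P h z a) (map_add (e n) x y)).trans
        ((piMod P (∐ X)).add_smulₓ h (e n x) (e n y) a)
    refine (congrArg (φ l) hxy).trans (((φ l).map_add _ _).trans ?_)
    refine (congrArg₂ (· + ·) hx hy).trans ((M.add_smulₓ h _ _ a).symm.trans ?_)
    rw [← map_add, ← map_add]

/-- Module morphisms out of the homotopy of a coproduct are determined on the summands. -/
theorem GHom.ext_of_sigma (hP : IsCompactObj P) {ι : Type v} {X : ι → C} {M : GradedModule P}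
    {φ ψ : GHom (piMod P (∐ X)) M}
    (h : ∀ i, φ.comp (piGHom P (Sigma.ι X i)) = ψ.comp (piGHom P (Sigma.ι X i))) : φ = ψ := by
  classical
  refine GHom.ext fun n u => ?_
  obtain ⟨e, he⟩ := hP.exists_addEquiv_shift X n
  obtain ⟨w, rfl⟩ := e.surjective u
  induction w using DirectSum.induction_on with
  | zero => rw [map_zero, map_zero, map_zero]
  | of i f =>
    rw [he]
    exact GHom.congr_app (h i) n f
  | add x y hx hy => rw [map_add, map_add, map_add, hx, hy]

/-- Morphisms out of `Q` are the same as module morphisms out of `π_* Q`. -/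
def HomotopyFull (P Q : C) : Prop :=
  ∀ Y : C, Function.Bijective (fun f : Q ⟶ Y => piGHom P f)

theorem piGHom_comp {X Y Z : C} (f : X ⟶ Y) (g : Y ⟶ Z) :
    piGHom P (f ≫ g) = (piGHom P g).comp (piGHom P f) :=
  GHom.ext fun _ u => (Category.assoc u f g).symm

theorem piGHom_id (X : C) : piGHom P (𝟙 X) = GHom.id (piMod P X) :=
  GHom.ext fun _ u => Category.comp_id u

theorem homotopyFull_shift (P : C) (m : ℤ) : HomotopyFull P (P⟦m⟧) := by
  intro Y
  refine ⟨fun f g h => ?_, fun φ => ⟨φ.app m (𝟙 _), GHom.ext_of_id (Category.id_comp _)⟩⟩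
  exact (Category.id_comp f).symm.trans
    ((GHom.congr_app h m (𝟙 _)).trans (Category.id_comp g))

theorem homotopyFull_sigma (hP : IsCompactObj P) {ι : Type v} (X : ι → C)
    (hX : ∀ i, HomotopyFull P (X i)) : HomotopyFull P (∐ X) := by
  intro Y
  refine ⟨fun f g h => ?_, fun φ => ?_⟩
  · refine Sigma.hom_ext _ _ fun i => (hX i Y).1 ?_
    change piGHom P f = piGHom P g at h
    change piGHom P _ = piGHom P _
    rw [piGHom_comp, piGHom_comp, h]
  · choose f hf using fun i => (hX i Y).2 (φ.comp (piGHom P (Sigma.ι X i)))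
    refine ⟨Sigma.desc f, GHom.ext_of_sigma hP fun i => ?_⟩
    change (piGHom P _).comp _ = _
    rw [← piGHom_comp, Sigma.ι_desc]
    exact hf i

theorem HomotopyFull.of_retract {Q Q' : C} (hQ : HomotopyFull P Q) (i : Q' ⟶ Q) (p : Q ⟶ Q')
    (hip : i ≫ p = 𝟙 Q') : HomotopyFull P Q' := by
  intro Y
  refine ⟨fun f g h => ?_, fun φ => ?_⟩
  · change piGHom P f = piGHom P g at h
    have : p ≫ f = p ≫ g := (hQ Y).1 (by
      change piGHom P _ = piGHom P _
      rw [piGHom_comp, piGHom_comp, h])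
    rw [← Category.id_comp f, ← Category.id_comp g, ← hip, Category.assoc, this, Category.assoc]
  · obtain ⟨f, hf⟩ := (hQ Y).2 (φ.comp (piGHom P p))
    refine ⟨i ≫ f, ?_⟩
    change piGHom P f = _ at hf
    change piGHom P _ = _
    rw [piGHom_comp, hf]
    change φ.comp ((piGHom P p).comp (piGHom P i)) = φ
    rw [← piGHom_comp, hip, piGHom_id]
    rfl

/-- Every graded module is a quotient of the homotopy of a coproduct of shifts of `P`. -/
theorem exists_cover (hP : IsCompactObj P) (M : GradedModule P) :
    ∃ (Q : C) (e : GHom (piMod P Q) M), HomotopyFull P Q ∧ e.Surj := by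
  choose g hg using fun p : (Σ n, M.M n) => exists_GHom_of_element M p.2
  obtain ⟨φ, hφ⟩ := exists_GHom_sigma hP (fun p : (Σ n, M.M n) => P⟦p.1⟧) g
  refine ⟨_, φ, homotopyFull_sigma hP _ fun p => homotopyFull_shift P p.1, fun n x => ?_⟩
  exact ⟨_, (GHom.congr_app (hφ ⟨n, x⟩) n (𝟙 _)).trans (hg ⟨n, x⟩)⟩

end Coproducts

section IdempotentSplitting

variable [HasCoproducts.{v} C]

/-- Idempotents split in a triangulated category with countable coproducts. -/
theorem exists_splitting {Q : C} (e : Q ⟶ Q) (he : e ≫ e = e) :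
    ∃ (Q' : C) (i : Q' ⟶ Q) (p : Q ⟶ Q'), i ≫ p = 𝟙 Q' ∧ p ≫ i = e := by
  let A : C := ∐ fun _ : ULift.{v} ℕ => Q
  let ι : ℕ → (Q ⟶ A) := fun k => Sigma.ι (fun _ : ULift.{v} ℕ => Q) ⟨k⟩
  let desc : ∀ {Z : C}, (ℕ → (Q ⟶ Z)) → (A ⟶ Z) := fun f => Sigma.desc fun k => f k.down
  have hdesc : ∀ {Z : C} (f : ℕ → (Q ⟶ Z)) (k : ℕ), ι k ≫ desc f = f k :=
    fun f k => Sigma.ι_desc _ _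
  have hext : ∀ {Z : C} {f g : A ⟶ Z}, (∀ k, ι k ≫ f = ι k ≫ g) → f = g :=
    fun h => Sigma.hom_ext _ _ fun k => h k.down
  let s : A ⟶ A := desc fun k => (𝟙 Q - e) ≫ ι k + e ≫ ι (k + 1)
  let r₀ : ℕ → (Q ⟶ A) := fun k => Nat.casesOn k 0 fun k => e ≫ ι k
  let r : A ⟶ A := desc fun k => (𝟙 Q - e) ≫ ι k + r₀ k
  let u : Q ⟶ A := e ≫ ι 0
  let v₀ : ℕ → (Q ⟶ Q) := fun k => Nat.casesOn k e fun _ => 0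
  let v : A ⟶ Q := desc v₀
  have hs : ∀ k, ι k ≫ s = (𝟙 Q - e) ≫ ι k + e ≫ ι (k + 1) := fun k =>
    hdesc (fun k => (𝟙 Q - e) ≫ ι k + e ≫ ι (k + 1)) k
  have hr : ∀ k, ι k ≫ r = (𝟙 Q - e) ≫ ι k + r₀ k := fun k =>
    hdesc (fun k => (𝟙 Q - e) ≫ ι k + r₀ k) k
  have hv : ∀ k, ι k ≫ v = v₀ k := fun k => hdesc v₀ k
  have he' : ∀ {Z : C} (f : Q ⟶ Z), e ≫ e ≫ f = e ≫ f := fun f => by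
    rw [← Category.assoc, he]
  have hsr : s ≫ r = 𝟙 A := hext fun k => by
    rw [← Category.assoc, hs, Preadditive.add_comp, Category.assoc, Category.assoc, hr, hr]
    cases k <;> simp [r₀, he']
  have hsv : s ≫ v = 0 := hext fun k => by
    rw [← Category.assoc, hs, Preadditive.add_comp, Category.assoc, Category.assoc, hv, hv]
    cases k <;> simp [v₀, he]
  have hrs : r ≫ s + v ≫ u = 𝟙 A := hext fun k => by
    rw [Preadditive.comp_add, ← Category.assoc, ← Category.assoc, hr, hv, Preadditive.add_comp,
      Category.assoc, hs]
    cases k with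
    | zero => simp [r₀, v₀, u, he']
    | succ k => simp [r₀, v₀, u, he', hs]
  have huv : u ≫ v = e := by
    rw [Category.assoc, hv, ← he]
    simp [v₀, he]
  obtain ⟨Z, c, δ, hT⟩ := distinguished_cocone_triangle s
  have hmono : Mono s := mono_of_mono_fac hsr
  have hc : Epi c := Triangle.epi₂ _ hT (Triangle.mor₃_eq_zero_of_mono₁ _ hT hmono)
  have hsc : s ≫ c = 0 := comp_distTriang_mor_zero₁₂ _ hT
  obtain ⟨q, hq⟩ : ∃ q : Z ⟶ Q, v = c ≫ q := Triangle.yoneda_exact₂ _ hT v hsv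
  refine ⟨Z, q, u ≫ c, ?_, ?_⟩
  · rw [← cancel_epi c, ← Category.assoc, ← hq, Category.comp_id, ← Category.assoc,
      ← sub_eq_iff_eq_add'.2 hrs.symm, Preadditive.sub_comp, Category.assoc, hsc, comp_zero,
      sub_zero, Category.id_comp]
  · rw [Category.assoc, ← hq, huv]

end IdempotentSplitting

section Realization

variable [HasCoproducts.{v} C] {P : C}

/-- Every projective graded module is the homotopy of an object from which maps are computed
by module morphisms. -/
theorem exists_realization (hP : IsCompactObj P) {F : GradedModule P} (hF : IsProjective F) :
    ∃ (Q : C) (θ : GHom (piMod P Q) F), HomotopyFull P Q ∧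
      ∀ n, Function.Bijective (θ.app n) := by
  obtain ⟨Q, e, hQ, he⟩ := exists_cover hP F
  obtain ⟨s, hs⟩ := hF _ _ e he (GHom.id F)
  obtain ⟨ε, hε⟩ := (hQ Q).2 (s.comp e)
  replace hε : piGHom P ε = s.comp e := hε
  have hidem : ε ≫ ε = ε := (hQ Q).1 (by
    change piGHom P _ = piGHom P _
    rw [piGHom_comp, hε]
    change s.comp ((e.comp s).comp e) = _
    rw [hs]
    rfl)
  obtain ⟨Q', i, p, hip, hpi⟩ := exists_splitting ε hidem
  have h₁ : (e.comp (piGHom P i)).comp ((piGHom P p).comp s) = GHom.id F := by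
    change (e.comp ((piGHom P i).comp (piGHom P p))).comp s = _
    rw [← piGHom_comp, hpi, hε]
    change (e.comp s).comp (e.comp s) = _
    rw [hs]
    rfl
  have h₂ : ((piGHom P p).comp s).comp (e.comp (piGHom P i)) = GHom.id _ := by
    change (piGHom P p).comp ((s.comp e).comp (piGHom P i)) = _
    rw [← hε, ← piGHom_comp, ← piGHom_comp, ← piGHom_id]
    congr 1
    rw [← hpi]
    simp [hip]
  exact ⟨Q', e.comp (piGHom P i), hQ.of_retract i p hip, fun n =>
    Function.bijective_iff_has_inverse.2 ⟨((piGHom P p).comp s).app n,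
      fun x => GHom.congr_app h₂ n x, fun x => GHom.congr_app h₁ n x⟩⟩

/-- A morphism inducing a bijection on homotopy is an isomorphism. -/
theorem IsGenerator.isIso (hgen : IsGenerator P) {X Y : C} (f : X ⟶ Y)
    (hf : ∀ n, Function.Bijective ((piGHom P f).app n)) : IsIso f := by
  obtain ⟨Z, g, δ, hT⟩ := distinguished_cocone_triangle f
  refine (Triangle.isZero₃_iff_isIso₁ _ hT).1 (hgen Z fun n u => ?_)
  obtain ⟨w, hw⟩ := exists_desuspension P (show (n - 1) + 1 = n by omega) (u ≫ δ)
  have hδ : u ≫ δ = 0 := by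
    have h0 : w ≫ f = 0 := desuspension_injective P (show (n - 1) + 1 = n by omega) (by
      rw [Functor.map_comp, ← Category.assoc, hw, Category.assoc]
      have : δ ≫ f⟦(1 : ℤ)⟧' = 0 := comp_distTriang_mor_zero₃₁ _ hT
      rw [this]
      simp)
    have hw0 : w = 0 := (hf _).1 (h0.trans (map_zero ((piGHom P f).app _)).symm)
    rw [← hw, hw0]
    simp
  obtain ⟨v, hv⟩ := Triangle.coyoneda_exact₃ _ hT u hδ
  obtain ⟨w, rfl⟩ := (hf n).2 v
  have hfg : f ≫ g = 0 := comp_distTriang_mor_zero₁₂ _ hT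
  rw [hv]
  change (w ≫ f) ≫ g = 0
  rw [Category.assoc, hfg, comp_zero]

theorem homotopyFull_of_isProjective (hP : IsCompactObj P) (hgen : IsGenerator P) {W : C}
    (hW : IsProjective (piMod P W)) : HomotopyFull P W := by
  obtain ⟨Q, θ, hQ, hθ⟩ := exists_realization hP hW
  obtain ⟨f, rfl⟩ := (hQ W).2 θ
  have := hgen.isIso f hθ
  exact hQ.of_retract (inv f) f (IsIso.inv_hom_id f)

/-- Given a projective resolution of `π_* W`, the object `W` has a cover `g : Q ⟶ W`
realizing the augmentation, whose fibre `W'` realizes the first syzygy. -/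
theorem exists_realized_syzygy (hP : IsCompactObj P) {W : C} (R : ProjResolution (piMod P W)) :
    ∃ (W' Q : C) (f : W' ⟶ Q) (g : Q ⟶ W) (δ : W ⟶ W'⟦(1 : ℤ)⟧)
      (θ : GHom (piMod P Q) (R.F 0)) (aug : GHom (R.F 1) (piMod P W')),
      Triangle.mk f g δ ∈ distTriang C ∧ HomotopyFull P Q ∧
      (∀ n, Function.Bijective (θ.app n)) ∧
      IsShortExact (piGHom P f) (piGHom P g) ∧
      (∀ n, Function.Surjective (aug.app n)) ∧
      (∀ (n : ℤ) (x : (R.F 1).M n), aug.app n x = 0 ↔ x ∈ Set.range ((R.d 1).app n)) ∧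
      θ.comp ((piGHom P f).comp aug) = R.d 0 := by
  obtain ⟨Q, θ, hQ, hθ⟩ := exists_realization hP (R.projective 0)
  obtain ⟨g, hg⟩ := (hQ W).2 (R.aug.comp θ)
  replace hg : piGHom P g = R.aug.comp θ := hg
  obtain ⟨W', f, δ, hT⟩ := distinguished_cocone_triangle₁ g
  have hfg : f ≫ g = 0 := comp_distTriang_mor_zero₁₂ _ hT
  have hgδ : g ≫ δ = 0 := comp_distTriang_mor_zero₂₃ _ hT
  have hsurj : ∀ n, Function.Surjective ((piGHom P g).app n) := fun n => by
    rw [hg]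
    exact (R.aug_surjective n).comp (hθ n).2
  have hinj : ∀ (n : ℤ) (w : P⟦n⟧ ⟶ W'), w ≫ f = 0 → w = 0 := fun n w hw => by
    let p : P⟦n + 1⟧ ⟶ W'⟦(1 : ℤ)⟧ :=
      (shiftFunctorAdd' C n 1 (n + 1) rfl).hom.app P ≫ w⟦(1 : ℤ)⟧'
    have hp : p ≫ f⟦(1 : ℤ)⟧' = 0 := by
      rw [Category.assoc, ← Functor.map_comp, hw, Functor.map_zero, comp_zero]
    obtain ⟨v, hv⟩ : ∃ v : P⟦n + 1⟧ ⟶ W, p = v ≫ δ := Triangle.coyoneda_exact₁ _ hT p hp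
    obtain ⟨z, hz⟩ : ∃ z : P⟦n + 1⟧ ⟶ Q, z ≫ g = v := hsurj _ v
    have hp0 : p = 0 := by rw [hv, ← hz, Category.assoc, hgδ, comp_zero]
    exact desuspension_injective P rfl (hp0.trans (by simp))
  have hS : IsShortExact (piGHom P f) (piGHom P g) := by
    refine ⟨fun n => (injective_iff_map_eq_zero _).2 fun w hw => ?_, hsurj, fun n x => ?_⟩
    · exact hinj n w hw
    · constructor
      · intro hx
        obtain ⟨y, hy⟩ := Triangle.coyoneda_exact₂ _ hT x hx
        exact ⟨y, hy.symm⟩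
      · rintro ⟨y, rfl⟩
        change (y ≫ f) ≫ g = 0
        rw [Category.assoc, hfg, comp_zero]
  obtain ⟨θ', hθθ', hθ'θ⟩ := θ.exists_inverse hθ
  have hθ₁ : ∀ n x, θ.app n (θ'.app n x) = x := fun n x => GHom.congr_app hθθ' n x
  have hgθ' : ∀ n x, (piGHom P g).app n (θ'.app n x) = R.aug.app n x := fun n x => by
    rw [hg, GHom.comp_app, hθ₁]
  obtain ⟨aug, haug⟩ := (piGHom P f).exists_lift hS.mono (θ'.comp (R.d 0)) fun n x =>
    (hS.exact n _).1 (by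
      rw [GHom.comp_app, hgθ']
      exact (R.exact_aug n _).2 ⟨x, rfl⟩)
  refine ⟨W', Q, f, g, δ, θ, aug, hT, hQ, hθ, hS, fun n y => ?_, fun n x => ?_,
    GHom.ext fun n x => ?_⟩
  · have hy : R.aug.app n (θ.app n ((piGHom P f).app n y)) = 0 := by
      have := GHom.congr_app hg n ((piGHom P f).app n y)
      rw [(hS.exact n _).2 ⟨y, rfl⟩] at this
      exact this.symm
    obtain ⟨x, hx⟩ := (R.exact_aug n _).1 hy
    refine ⟨x, hS.mono n ?_⟩
    rw [haug, GHom.comp_app, hx]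
    exact GHom.congr_app hθ'θ n _
  · rw [← R.exact_d, ← map_eq_zero_iff _ (hS.mono n), haug, GHom.comp_app]
    refine ⟨fun h => ?_, fun h => by rw [h, map_zero]⟩
    rw [← hθ₁ n ((R.d 0).app n x), h, map_zero]
  · rw [GHom.comp_app, GHom.comp_app, haug, GHom.comp_app, hθ₁]

/-- The connecting homomorphism `Hom(W', Y) → Hom(W, Y⟦1⟧)` of a triangle
`W' → Q → W → W'⟦1⟧`. -/
def connectingHom {W W' : C} (δ : W ⟶ W'⟦(1 : ℤ)⟧) (Y : C) :
    (W' ⟶ Y) →+ (W ⟶ Y⟦(1 : ℤ)⟧) :=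
  AddMonoidHom.mk' (fun f => δ ≫ f⟦(1 : ℤ)⟧') fun f g => by
    simp [Functor.map_add, Preadditive.comp_add]

theorem connectingHom_surjective {W' Q W : C} {f : W' ⟶ Q} {g : Q ⟶ W}
    {δ : W ⟶ W'⟦(1 : ℤ)⟧} (hT : Triangle.mk f g δ ∈ distTriang C) {Y : C}
    (hQ : ∀ u : Q ⟶ Y⟦(1 : ℤ)⟧, u = 0) : Function.Surjective (connectingHom δ Y) := by
  intro u
  obtain ⟨w, hw⟩ := Triangle.yoneda_exact₃ _ hT u (hQ _)
  obtain ⟨w, rfl⟩ := (shiftFunctor C (1 : ℤ)).map_surjective w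
  exact ⟨w, hw.symm⟩

theorem connectingHom_eq_zero_iff {W' Q W : C} {f : W' ⟶ Q} {g : Q ⟶ W}
    {δ : W ⟶ W'⟦(1 : ℤ)⟧} (hT : Triangle.mk f g δ ∈ distTriang C) {Y : C} (u : W' ⟶ Y) :
    connectingHom δ Y u = 0 ↔ ∃ q : Q ⟶ Y, f ≫ q = u := by
  constructor
  · intro hu
    obtain ⟨q, hq⟩ : ∃ q : Q⟦(1 : ℤ)⟧ ⟶ Y⟦(1 : ℤ)⟧, u⟦(1 : ℤ)⟧' = (-f⟦(1 : ℤ)⟧') ≫ q :=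
      Triangle.yoneda_exact₂ _ (rot_of_distTriang _ (rot_of_distTriang _ hT)) (u⟦(1 : ℤ)⟧') hu
    obtain ⟨q, rfl⟩ := (shiftFunctor C (1 : ℤ)).map_surjective q
    refine ⟨-q, (shiftFunctor C (1 : ℤ)).map_injective ?_⟩
    rw [hq]
    simp
  · rintro ⟨q, rfl⟩
    change δ ≫ (f ≫ q)⟦(1 : ℤ)⟧' = 0
    have : δ ≫ f⟦(1 : ℤ)⟧' = 0 := comp_distTriang_mor_zero₃₁ _ hT
    rw [Functor.map_comp, reassoc_of% this, zero_comp]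

/-- Maps between objects with homotopy in the same residue class vanish after a shift not
divisible by `N`. -/
theorem hom_shift_eq_zero {N : ℕ} {i : ZMod N} {Q Y : C} (hQ : HomotopyFull P Q)
    (hQi : InDegrees N i (piMod P Q)) (hYi : InDegrees N i (piMod P Y)) {k : ℤ}
    (hk : ¬ (N : ℤ) ∣ k) (f : Q ⟶ Y⟦k⟧) : f = 0 := by
  refine (hQ _).1 (GHom.ext fun n u => ?_)
  change u ≫ f = u ≫ 0
  rw [comp_zero]
  by_cases hn : (n : ZMod N) = i
  · obtain ⟨w, hw⟩ := exists_desuspension P (show (n - k) + k = n by omega) (u ≫ f)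
    have hw0 : w = 0 := hYi (n - k) (fun h => hk (by
      rw [Int.cast_sub, hn, sub_eq_self] at h
      exact (ZMod.intCast_zmod_eq_zero_iff_dvd k N).1 h)) w
    rw [← hw, hw0]
    simp
  · rw [hQi n hn u, zero_comp]

/-- The isomorphism `Hom(W, Y⟦1⟧) ≅ Ext¹(π_* W, π_* Y)` when the first syzygy of `π_* W` is
projective and `π_* Y` is concentrated in the degrees of the resolution. -/
theorem nonempty_hom_addEquiv_extGroup_zero (hP : IsCompactObj P) (hgen : IsGenerator P)
    {N : ℕ} (hN : 2 ≤ N) {i : ZMod N} {Y : C} (hY : InDegrees N i (piMod P Y)) {W : C}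
    (R : ProjResolution (piMod P W)) (hR : ∀ k, InDegrees N i (R.F k))
    (hW : SyzygiesProjective 1 (piMod P W)) :
    Nonempty ((W ⟶ Y⟦(1 : ℤ)⟧) ≃+ extGroup R (piMod P Y) 0) := by
  obtain ⟨W', Q, f, g, δ, θ, aug, hT, hQ, hθ, hS, haug₁, haug₂, hd⟩ :=
    exists_realized_syzygy hP R
  obtain ⟨θ', hθθ', hθ'θ⟩ := θ.exists_inverse hθ
  have hQp : IsProjective (piMod P Q) :=
    (R.projective 0).of_retract θ θ' fun n x => GHom.congr_app hθ'θ n x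
  have hQi : InDegrees N i (piMod P Q) := fun n hn x => (hθ n).1 (by
    rw [hR 0 n hn (θ.app n x), map_zero])
  have hW' : HomotopyFull P W' := homotopyFull_of_isProjective hP hgen (hW _ _ _ _ hQp hS)
  let A : (W' ⟶ Y) →+ AddMonoidHom.ker (cochainD R (piMod P Y) 1) :=
    (AddMonoidHom.mk' (fun u : W' ⟶ Y => (piGHom P u).comp aug) fun u v =>
      GHom.ext fun n x => Preadditive.comp_add _ _ _ (aug.app n x) u v).codRestrict _ fun u =>
      AddMonoidHom.mem_ker.2 (GHom.ext fun n x => by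
        change (piGHom P u).app n (aug.app n ((R.d 1).app n x)) = 0
        rw [(haug₂ n _).2 ⟨x, rfl⟩, map_zero])
  have hA : ∀ u, (A u).1 = (piGHom P u).comp aug := fun u => rfl
  refine nonempty_addEquiv_of_ker_eq (connectingHom δ Y)
    ((extGroupMk R (piMod P Y) 0).comp A)
    (connectingHom_surjective hT fun u => hom_shift_eq_zero hQ hQi hY (fun h => ?_) u)
    ((extGroupMk_surjective R _ 0).comp ?_) fun u => ?_
  · have := Int.le_of_dvd one_pos h
    omega
  · rintro ⟨φ, hφ⟩
    have hφ' : ∀ n x, φ.app n ((R.d 1).app n x) = 0 := fun n x => GHom.congr_app hφ n x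
    have hker : ∀ n x, aug.app n x = 0 → φ.app n x = 0 := fun n x hx => by
      obtain ⟨y, rfl⟩ := (haug₂ n x).1 hx
      exact hφ' n y
    have hwd : ∀ n x y, aug.app n x = aug.app n y → φ.app n x = φ.app n y := fun n x y h => by
      rw [← sub_eq_zero, ← map_sub]
      exact hker n _ (by rw [map_sub, h, sub_self])
    choose s hs using haug₁
    let ψ : GHom (piMod P W') (piMod P Y) :=
      { app := fun n => AddMonoidHom.mk' (fun x => φ.app n (s n x)) fun x y => by
          rw [← map_add]
          exact hwd n _ _ (by rw [map_add, hs, hs, hs])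
        app_smul := fun {n k l} h m a => (hwd l _ _ (by
          rw [hs, aug.app_smul, hs])).trans (φ.app_smul h (s n m) a) }
    obtain ⟨u, hu⟩ := (hW' Y).2 ψ
    refine ⟨u, Subtype.ext ?_⟩
    rw [hA]
    change piGHom P u = ψ at hu
    rw [hu]
    exact GHom.ext fun n x => hwd n _ _ (hs n _)
  · rw [connectingHom_eq_zero_iff hT, AddMonoidHom.comp_apply, extGroupMk_eq_zero_iff, hA]
    constructor
    · rintro ⟨q, rfl⟩
      refine ⟨(piGHom P q).comp θ', ?_⟩
      rw [← hd, piGHom_comp]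
      change (piGHom P q).comp ((θ'.comp θ).comp ((piGHom P f).comp aug)) = _
      rw [hθ'θ]
      rfl
    · rintro ⟨t, ht⟩
      obtain ⟨q, hq⟩ := (hQ Y).2 (t.comp θ)
      change piGHom P q = _ at hq
      refine ⟨q, (hW' Y).1 ?_⟩
      change piGHom P _ = piGHom P _
      rw [piGHom_comp, hq]
      refine GHom.ext fun n y => ?_
      obtain ⟨x, rfl⟩ := haug₁ n y
      rw [← hd] at ht
      exact GHom.congr_app ht n x

/-- The isomorphism `Hom(W, Y⟦j + 1⟧) ≅ Ext^{j+1}(π_* W, π_* Y)`, obtained by dimension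
shifting along the realized syzygies. -/
theorem nonempty_hom_addEquiv_extGroup (hP : IsCompactObj P) (hgen : IsGenerator P)
    {N : ℕ} {i : ZMod N} {Y : C} (hY : InDegrees N i (piMod P Y)) (j : ℕ) :
    ∀ (W : C) (R : ProjResolution (piMod P W)), (∀ k, InDegrees N i (R.F k)) →
      SyzygiesProjective (j + 1) (piMod P W) → j + 2 ≤ N →
      Nonempty ((W ⟶ Y⟦((j + 1 : ℕ) : ℤ)⟧) ≃+ extGroup R (piMod P Y) j) := by
  induction j with
  | zero =>
    intro W R hR hW hN
    exact nonempty_hom_addEquiv_extGroup_zero hP hgen hN hY R hR hW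
  | succ j ih =>
    intro W R hR hW hN
    obtain ⟨W', Q, f, g, δ, θ, aug, hT, hQ, hθ, hS, haug₁, haug₂, hd⟩ :=
      exists_realized_syzygy hP R
    obtain ⟨θ', hθθ', hθ'θ⟩ := θ.exists_inverse hθ
    have hQp : IsProjective (piMod P Q) :=
      (R.projective 0).of_retract θ θ' fun n x => GHom.congr_app hθ'θ n x
    have hQi : InDegrees N i (piMod P Q) := fun n hn x => (hθ n).1 (by
      rw [hR 0 n hn (θ.app n x), map_zero])
    obtain ⟨e⟩ := ih W' (R.tail aug haug₁ haug₂) (fun k => hR (k + 1)) (hW _ _ _ _ hQp hS)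
      (by omega)
    have hvan : ∀ k : ℕ, 0 < k → k < N → ∀ u : Q ⟶ Y⟦(k : ℤ)⟧, u = 0 := fun k hk hkN u =>
      hom_shift_eq_zero hQ hQi hY (fun h => by
        have := Nat.le_of_dvd hk (Int.natCast_dvd_natCast.1 h)
        omega) u
    let α := (shiftFunctorAdd' C ((j + 1 : ℕ) : ℤ) 1 ((j + 1 + 1 : ℕ) : ℤ)
      (by push_cast; rfl)).app Y
    let e₁ : (W ⟶ (Y⟦((j + 1 : ℕ) : ℤ)⟧)⟦(1 : ℤ)⟧) ≃+ (W ⟶ Y⟦((j + 1 + 1 : ℕ) : ℤ)⟧) :=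
      { toFun := fun u => u ≫ α.inv
        invFun := fun u => u ≫ α.hom
        left_inv := fun u => by simp
        right_inv := fun u => by simp
        map_add' := fun u v => Preadditive.add_comp _ _ _ _ _ _ }
    have hinj : Function.Injective (connectingHom δ (Y⟦((j + 1 : ℕ) : ℤ)⟧)) :=
      (injective_iff_map_eq_zero _).2 fun u hu => by
        obtain ⟨q, rfl⟩ := (connectingHom_eq_zero_iff hT u).1 hu
        rw [hvan _ (by omega) (by omega) q, comp_zero]
    have hsurj : Function.Surjective (connectingHom δ (Y⟦((j + 1 : ℕ) : ℤ)⟧)) :=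
      connectingHom_surjective hT fun u => by
        have h := hvan (j + 1 + 1) (by omega) (by omega) (u ≫ α.inv)
        exact (cancel_mono α.inv).1 (h.trans zero_comp.symm)
    exact ⟨(e₁.symm.trans (AddEquiv.ofBijective _ ⟨hinj, hsurj⟩).symm).trans e⟩

end Realization

section Suspension

/-- Desuspension of morphisms, `Hom(X⟦a⟧, Y) ≅ Hom(X⟦c⟧, Y⟦b⟧)` for `a + b = c`. -/
theorem nonempty_hom_addEquiv_shift (X Y : C) {a b c : ℤ} (h : a + b = c) :
    Nonempty ((X⟦a⟧ ⟶ Y) ≃+ (X⟦c⟧ ⟶ Y⟦b⟧)) :=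
  ⟨AddEquiv.ofBijective
    (AddMonoidHom.mk' (fun u : X⟦a⟧ ⟶ Y => (shiftFunctorAdd' C a b c h).hom.app X ≫ u⟦b⟧')
      fun u v => by simp [Functor.map_add, Preadditive.comp_add])
    ⟨fun _ _ => desuspension_injective X h, exists_desuspension X h⟩⟩

theorem inDegrees_shift {P X : C} {N : ℕ} {i : ZMod N} (hX : InDegrees N i (piMod P X)) :
    InDegrees N i (piMod P (X⟦(N : ℤ)⟧)) := fun n hn x => by
  obtain ⟨y, rfl⟩ := (suspensionGHom_bijective P X N n).2 x
  have hy : y = 0 := hX (n - N) (by simpa using hn) y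
  rw [hy, map_zero]

/-- A projective resolution of `(π_* X)[k]` regarded as one of `π_* (X⟦k⟧)`. -/
def ProjResolution.suspension {P X : C} {k : ℤ} (R : ProjResolution (gshift k (piMod P X))) :
    ProjResolution (piMod P (X⟦k⟧)) :=
  R.withAug ((suspensionGHom P X k).comp R.aug)
    (fun n => (suspensionGHom_bijective P X k n).2.comp (R.aug_surjective n)) fun n x => by
      rw [← R.exact_aug n x, GHom.comp_app,
        map_eq_zero_iff _ (suspensionGHom_bijective P X k n).1]

end Suspension

/-- Let `P` be a compact generator of the triangulated category `C`,
with `Λ` `N`-sparse and `gl dim Λ < N`; fix `i ∈ ℤ/N` and objects `X, Y` with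
`π_* X, π_* Y ∈ B[i]`. Then `Hom_T(ΣX, Y) ≅ Ext^{N-1}_Λ((π_* X)[N], π_* Y)` as abelian
groups, where `Ext^{N-1}` is computed from any projective resolution of `(π_* X)[N]`
(note `N - 1 = (N - 2) + 1`). -/
theorem statement_4 [IsTriangulated C] [HasCoproducts.{v} C]
    (P : C) (hcpt : IsCompactObj P) (hgen : IsGenerator P)
    (N : ℕ) (hN : 2 ≤ N) (hsp : Sparse P N)
    (hgl : ∀ M : GradedModule P, projDimLE (N - 1) M)
    (i : ZMod N) (X Y : C)
    (hX : InDegrees N i (piMod P X)) (hY : InDegrees N i (piMod P Y))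
    (R : ProjResolution (gshift (N : ℤ) (piMod P X))) :
    Nonempty ((X⟦(1:ℤ)⟧ ⟶ Y) ≃+ extGroup R (piMod P Y) (N - 2)) := by
  obtain ⟨m, rfl⟩ := Nat.exists_eq_add_of_le' hN
  have hXN := inDegrees_shift hX
  obtain ⟨e₁⟩ := nonempty_hom_addEquiv_shift X Y
    (show (1 : ℤ) + ((m + 1 : ℕ) : ℤ) = ((m + 2 : ℕ) : ℤ) by push_cast; ring)
  obtain ⟨e₂⟩ := nonempty_hom_addEquiv_extGroup hcpt hgen hY m _
    (R.suspension.degreePart hsp i hXN) (fun k => inDegrees_degreePart hsp i _)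
    (hgl _).syzygiesProjective le_rfl
  obtain ⟨e₃⟩ := nonempty_extGroup_degreePart_addEquiv hsp i hXN R.suspension _ hY m
  exact ⟨(e₁.trans e₂).trans e₃.symm⟩

end Franke
end

section
/- Let A be an abelian category and let S: 0 → Z →ι C →ρ B → 0 and S̃: 0 → Z̃ →ι̃ C̃ →ρ̃ B̃ → 0 be short exact sequences in A. Given morphisms u: B → B̃ and w: Z → Z̃, there exists a morphism h: C → C̃ satisfying h ∘ ι = ι̃ ∘ w and ρ̃ ∘ h = u ∘ ρ if and only if w_*[S] = u^*[S̃] in Ext¹_A(B, Z̃). -/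
/-!
**Statement 9.** Let `A` be an abelian category, `S : 0 → Z → C → B → 0` and
`S' : 0 → Z' → C' → B' → 0` short exact sequences in `A`, and `u : B ⟶ B'`,
`w : Z ⟶ Z'` morphisms. Then there exists `h : C ⟶ C'` with `h ∘ ι = ι' ∘ w` and
`ρ' ∘ h = u ∘ ρ` if and only if `w_*[S] = u^*[S']` in `Ext¹_A(B, Z')`.
-/

open CategoryTheory CategoryTheory.Abelian

universe w v u

theorem statement_9 {A : Type u} [Category.{v} A] [Abelian A] [HasExt.{w} A]
    (S S' : ShortComplex A) (hS : S.ShortExact) (hS' : S'.ShortExact)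
    (u : S.X₃ ⟶ S'.X₃) (w : S.X₁ ⟶ S'.X₁) :
    (∃ h : S.X₂ ⟶ S'.X₂, S.f ≫ h = w ≫ S'.f ∧ h ≫ S'.g = S.g ≫ u) ↔
      hS.extClass.comp (Ext.mk₀ w) (add_zero 1) =
        (Ext.mk₀ u).comp hS'.extClass (zero_add 1) := by
  constructor
  · rintro ⟨h, h₁, h₂⟩
    exact hS.extClass_naturality hS' { τ₁ := w, τ₂ := h, τ₃ := u, comm₁₂ := h₁.symm, comm₂₃ := h₂ }
  · intro H
    -- Extend `w ≫ S'.f` along `S.f`.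
    obtain ⟨x, hx⟩ := Ext.contravariant_sequence_exact₁ hS S'.X₂
      (Ext.mk₀ (w ≫ S'.f)) (add_zero 1) (by
        rw [← Ext.mk₀_comp_mk₀, ← Ext.comp_assoc_of_third_deg_zero _ _ _ (add_zero 1), H,
          Ext.comp_assoc_of_third_deg_zero, hS'.extClass_comp, Ext.comp_zero])
    obtain ⟨h₀, rfl⟩ := Ext.homEquiv₀.symm.surjective x
    have h₁ : S.f ≫ h₀ = w ≫ S'.f := (Ext.mk₀_bijective _ _).injective (by simpa using hx)
    -- It induces some `u'` on cokernels, and `u - u'` lifts along `S'.g`.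
    have := hS.epi_g
    obtain ⟨u', hu'⟩ : ∃ u' : S.X₃ ⟶ S'.X₃, S.g ≫ u' = h₀ ≫ S'.g :=
      ⟨hS.exact.desc (h₀ ≫ S'.g) (by rw [reassoc_of% h₁, S'.zero, Limits.comp_zero]),
        hS.exact.g_desc _ _⟩
    have H' := hS.extClass_naturality hS'
      { τ₁ := w, τ₂ := h₀, τ₃ := u', comm₁₂ := h₁.symm, comm₂₃ := hu'.symm }
    obtain ⟨y, hy⟩ := Ext.covariant_sequence_exact₃ S.X₃ hS' (Ext.mk₀ (u - u')) (zero_add 1) (by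
      rw [sub_eq_add_neg, Ext.mk₀_add, Ext.mk₀_neg, Ext.add_comp, Ext.neg_comp, ← H,
        add_neg_eq_zero]
      exact H')
    obtain ⟨k, rfl⟩ := Ext.homEquiv₀.symm.surjective y
    have hk : k ≫ S'.g = u - u' := (Ext.mk₀_bijective _ _).injective (by simpa using hy)
    exact ⟨h₀ + S.g ≫ k, by simp [h₁], by simp [hk, hu']⟩
end
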